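/- arXiv:2408.07139 — 5 statements merged into one kernel-verified Lean document; each statement's English description precedes it below -/
import Mathlib

section
/- For every c > 0 and λ > 0, the map θ ↦ φ(c,λ,θ) from ℝ to ℝ is continuous and strictly increasing. -/
open OnePoint

/-- `Tan θ ∈ ℝ̄ = ℝ ∪ {∞}`: `tan θ` if `cos θ ≠ 0`, and `∞` if `cos θ = 0`. -/
noncomputable def Tan (θ : ℝ) : OnePoint ℝ :=
  if Real.cos θ = 0 then ∞ else (Real.tan θ : OnePoint ℝ)

/-- The map `Ξ^c(λ, ·) : ℝ̄ → ℝ̄`: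
`Ξ^c(λ,b) = b/(1 − b/c) + λ` for real `b ≠ c`, `Ξ^c(λ,c) = ∞`, `Ξ^c(λ,∞) = λ − c`. -/
noncomputable def Xi (c lam : ℝ) (b : OnePoint ℝ) : OnePoint ℝ :=
  OnePoint.rec ((lam - c : ℝ) : OnePoint ℝ)
    (fun b => if b = c then ∞ else ((b / (1 - b / c) + lam : ℝ) : OnePoint ℝ)) b

/-- `I(λ,c)`: the convex hull of the set of real fixed points of `b ↦ Ξ^c(λ,b)`. -/
noncomputable def Iset (lam c : ℝ) : Set ℝ :=
  if 4 * c ≤ lam then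
    Set.Icc ((lam - Real.sqrt (lam ^ 2 - 4 * lam * c)) / 2)
      ((lam + Real.sqrt (lam ^ 2 - 4 * lam * c)) / 2)
  else ∅

/-- The indicator `1_{I(λ,c)}` on `ℝ̄`, with `1_{I(λ,c)}(∞) := 0`. -/
noncomputable def indI (lam c : ℝ) (b : OnePoint ℝ) : ℝ :=
  OnePoint.rec 0 (fun x => (Iset lam c).indicator (fun _ => (1 : ℝ)) x) b

/-- The angle mapping
`φ(c,λ,θ) = inf {θ' : θ' ≥ θ + π·1_{I(λ,c)}(Tan θ), Tan θ' = Ξ^c(λ, Tan θ)}`. -/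
noncomputable def phi (c lam θ : ℝ) : ℝ :=
  sInf {θ' : ℝ | θ + Real.pi * indI lam c (Tan θ) ≤ θ' ∧ Tan θ' = Xi c lam (Tan θ)}

lemma aux_Tan_eq (a b : ℝ) : Tan a = Tan b ↔ Real.sin (a - b) = 0 := by
  unfold Tan
  rw [Real.sin_sub]
  have ha := Real.sin_sq_add_cos_sq a
  have hb := Real.sin_sq_add_cos_sq b
  by_cases h1 : Real.cos a = 0 <;> by_cases h2 : Real.cos b = 0
  · simp [h1, h2]
  · have : Real.sin a ≠ 0 := by
      intro h; simp [h, h1] at ha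
    simp [h1, h2, this]
  · have : Real.sin b ≠ 0 := by
      intro h; simp [h, h2] at hb
    simp [h1, h2, this]
  · simp only [h1, h2, if_false, OnePoint.coe_eq_coe, Real.tan_eq_sin_div_cos]
    rw [div_eq_div_iff h1 h2]
    constructor <;> intro h <;> linarith

lemma aux_Xi (c lam θ ψ r : ℝ) (hc : 0 < c) (hr : 0 < r)
    (hX : c * Real.cos θ - Real.sin θ = r * Real.cos ψ)
    (hY : c * Real.sin θ + lam * (c * Real.cos θ - Real.sin θ) = r * Real.sin ψ) :
    Xi c lam (Tan θ) = Tan ψ := by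
  have ha := Real.sin_sq_add_cos_sq θ
  have key : Real.cos ψ ≠ 0 → Real.tan ψ =
      (c * Real.sin θ + lam * (c * Real.cos θ - Real.sin θ)) /
        (c * Real.cos θ - Real.sin θ) := by
    intro h
    rw [hX, ← hX, hY, hX, Real.tan_eq_sin_div_cos, mul_div_mul_left _ _ hr.ne']
  by_cases h1 : Real.cos θ = 0
  · have hs : Real.sin θ ≠ 0 := by
      intro h; simp [h, h1] at ha
    have h2 : Real.cos ψ ≠ 0 := by
      intro h; simp [h, h1] at hX; exact hs hX
    have k := key h2
    have : Real.tan ψ = lam - c := by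
      rw [k, h1, div_eq_iff (by simpa using hs)]; ring
    simp only [Tan, h1, h2, if_true, if_false, this]
    rfl
  · have e : Real.tan θ = c ↔ Real.cos ψ = 0 := by
      rw [Real.tan_eq_sin_div_cos, div_eq_iff h1]
      constructor
      · intro h
        have : r * Real.cos ψ = 0 := by rw [← hX]; linarith
        simpa [hr.ne'] using this
      · intro h; rw [h] at hX; linarith
    by_cases h2 : Real.cos ψ = 0
    · have := e.2 h2
      simp only [Tan, h1, h2, if_true, if_false, this]
      change (if c = c then ∞ else _) = _
      simp
    · have h3 : Real.tan θ ≠ c := fun h => h2 (e.1 h)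
      have hX0 : c * Real.cos θ - Real.sin θ ≠ 0 := by
        rw [hX]; exact mul_ne_zero hr.ne' h2
      simp only [Tan, h1, h2, if_false]
      change (if Real.tan θ = c then ∞ else _) = _
      rw [if_neg h3, OnePoint.coe_eq_coe, key h2, Real.tan_eq_sin_div_cos]
      have : 1 - Real.sin θ / Real.cos θ / c = (c * Real.cos θ - Real.sin θ) / (c * Real.cos θ) := by
        field_simp
      rw [this]
      have hX1 : Real.cos θ * c - Real.sin θ ≠ 0 := by rwa [mul_comm]
      field_simp

lemma aux_ind (c lam θ : ℝ) (hc : 0 < c) (hlam : 0 < lam) :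
    indI lam c (Tan θ) =
      if Real.sin θ ^ 2 - lam * Real.sin θ * Real.cos θ + lam * c * Real.cos θ ^ 2 ≤ 0
      then 1 else 0 := by
  have ha := Real.sin_sq_add_cos_sq θ
  by_cases h1 : Real.cos θ = 0
  · have : ¬ (Real.sin θ ^ 2 - lam * Real.sin θ * Real.cos θ + lam * c * Real.cos θ ^ 2 ≤ 0) := by
      rw [h1] at ha ⊢; nlinarith
    rw [if_neg this]
    simp only [Tan, h1, if_true]
    rfl
  · simp only [Tan, h1, if_false]
    change (Iset lam c).indicator (fun _ => (1 : ℝ)) (Real.tan θ) = _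
    classical
    rw [Set.indicator_apply]
    refine if_congr ?_ rfl rfl
    set b := Real.tan θ with hb
    have hs : Real.sin θ = b * Real.cos θ := by rw [hb, Real.tan_mul_cos h1]
    have hq : Real.sin θ ^ 2 - lam * Real.sin θ * Real.cos θ + lam * c * Real.cos θ ^ 2
        = (b ^ 2 - lam * b + lam * c) * Real.cos θ ^ 2 := by rw [hs]; ring
    have hp : 0 < Real.cos θ ^ 2 := by positivity
    have e : (b ^ 2 - lam * b + lam * c) * Real.cos θ ^ 2 ≤ 0 ↔ b ^ 2 - lam * b + lam * c ≤ 0 := by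
      constructor
      · intro h; by_contra h'; push Not at h'; have := mul_pos h' hp; linarith
      · intro h; exact mul_nonpos_of_nonpos_of_nonneg h hp.le
    rw [hq, e]
    unfold Iset
    split_ifs with h4
    · have hD : 0 ≤ lam ^ 2 - 4 * lam * c := by nlinarith
      have e2 : b ^ 2 - lam * b + lam * c ≤ 0 ↔ |2 * b - lam| ≤ Real.sqrt (lam ^ 2 - 4 * lam * c) := by
        rw [Real.le_sqrt (abs_nonneg _) hD, sq_abs]
        constructor <;> intro h <;> nlinarith
      rw [e2, abs_le, Set.mem_Icc]
      constructor <;> rintro ⟨h, h'⟩ <;> constructor <;> linarith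
    · simp only [Set.mem_empty_iff_false, false_iff]
      push Not at h4 ⊢
      nlinarith [sq_nonneg (2 * b - lam)]

/-- minus the ratio of the image vector and the unit vector at angle `θ` -/
noncomputable def auxg (c lam θ : ℝ) : ℂ :=
  -(((c * Real.cos θ - Real.sin θ : ℝ) : ℂ) +
    ((c * Real.sin θ + lam * (c * Real.cos θ - Real.sin θ) : ℝ) : ℂ) * Complex.I) *
    (((Real.cos θ : ℝ) : ℂ) - ((Real.sin θ : ℝ) : ℂ) * Complex.I)

lemma auxg_im (c lam θ : ℝ) : (auxg c lam θ).im =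
    -(Real.sin θ ^ 2 - lam * Real.sin θ * Real.cos θ + lam * c * Real.cos θ ^ 2) := by
  simp only [auxg, Complex.mul_im, Complex.neg_re, Complex.neg_im, Complex.add_re, Complex.add_im,
    Complex.sub_re, Complex.sub_im, Complex.ofReal_re, Complex.ofReal_im, Complex.mul_re,
    Complex.I_re, Complex.I_im]
  ring

lemma auxg_re (c lam θ : ℝ) : (auxg c lam θ).re =
    -((c * Real.cos θ - Real.sin θ) * Real.cos θ +
      (c * Real.sin θ + lam * (c * Real.cos θ - Real.sin θ)) * Real.sin θ) := by
  simp only [auxg, Complex.mul_im, Complex.neg_re, Complex.neg_im, Complex.add_re, Complex.add_im,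
    Complex.sub_re, Complex.sub_im, Complex.ofReal_re, Complex.ofReal_im, Complex.mul_re,
    Complex.I_re, Complex.I_im]
  ring

lemma auxg_slit (c lam θ : ℝ) (hc : 0 < c) (hlam : 0 < lam) :
    auxg c lam θ ∈ Complex.slitPlane := by
  rw [Complex.mem_slitPlane_iff]
  by_cases h : (auxg c lam θ).im = 0
  · left
    rw [auxg_im] at h
    rw [auxg_re]
    have ha := Real.sin_sq_add_cos_sq θ
    generalize Real.sin θ = y at *
    generalize Real.cos θ = x at *
    have hx : x ≠ 0 := by
      rintro rfl; nlinarith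
    have hy : y ≠ 0 := by
      rintro rfl
      have : 0 < lam * c * x ^ 2 := by positivity
      linarith
    have h1 : 0 < x * y - c * x ^ 2 := by
      have : 0 < y ^ 2 := by positivity
      have : 0 < lam * (x * y - c * x ^ 2) := by linarith
      exact (mul_pos_iff_of_pos_left hlam).1 this
    have h2 : (-((c * x - y) * x + (c * y + lam * (c * x - y)) * y)) * x ^ 2
        = x * y - c * x ^ 2 := by
      linear_combination (x * y) * h + (-c * x ^ 2 + x * y) * ha
    have hp : 0 < x ^ 2 := by positivity
    rw [← h2] at h1
    exact (mul_pos_iff_of_pos_right hp).1 h1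
  · right; exact h

lemma auxZ (c lam θ : ℝ) :
    c * Real.cos θ - Real.sin θ = ‖auxg c lam θ‖ * Real.cos (θ + Real.pi + (auxg c lam θ).arg) ∧
    c * Real.sin θ + lam * (c * Real.cos θ - Real.sin θ)
      = ‖auxg c lam θ‖ * Real.sin (θ + Real.pi + (auxg c lam θ).arg) := by
  have h1 := Complex.norm_mul_cos_arg (auxg c lam θ)
  have h2 := Complex.norm_mul_sin_arg (auxg c lam θ)
  rw [auxg_re] at h1
  rw [auxg_im] at h2
  have ha := Real.sin_sq_add_cos_sq θ
  rw [show θ + Real.pi + (auxg c lam θ).arg = (θ + (auxg c lam θ).arg) + Real.pi by ring,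
    Real.cos_add_pi, Real.sin_add_pi, Real.cos_add, Real.sin_add]
  generalize ‖auxg c lam θ‖ = r at *
  generalize (auxg c lam θ).arg = t at *
  generalize Real.sin θ = y at *
  generalize Real.cos θ = x at *
  constructor
  · linear_combination x * h1 - y * h2 - (c * x - y) * ha
  · linear_combination y * h1 + x * h2 - (c * y + lam * (c * x - y)) * ha

lemma aux_phi (c lam θ : ℝ) (hc : 0 < c) (hlam : 0 < lam) :
    phi c lam θ = θ + Real.pi + (auxg c lam θ).arg := by
  have hs := auxg_slit c lam θ hc hlam
  have hr : 0 < ‖auxg c lam θ‖ := norm_pos_iff.2 (Complex.slitPlane_ne_zero hs)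
  obtain ⟨hX, hY⟩ := auxZ c lam θ
  have hXi := aux_Xi c lam θ _ _ hc hr hX hY
  have harg : (auxg c lam θ).arg < Real.pi :=
    lt_of_le_of_ne (Complex.arg_le_pi _) (Complex.mem_slitPlane_iff_arg.1 hs).1
  have harg' := Complex.neg_pi_lt_arg (auxg c lam θ)
  have hi := Complex.arg_nonneg_iff (z := auxg c lam θ)
  rw [auxg_im] at hi
  unfold phi
  apply IsLeast.csInf_eq
  rw [aux_ind c lam θ hc hlam, hXi]
  constructor
  · refine ⟨?_, rfl⟩
    split_ifs with h
    · have := hi.2 (by linarith)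
      linarith
    · linarith
  · rintro t ⟨h1, h2⟩
    rw [aux_Tan_eq, Real.sin_eq_zero_iff] at h2
    obtain ⟨n, hn⟩ := h2
    by_contra hlt
    push Not at hlt
    have hn0 : n < 0 := by
      by_contra h; push Not at h
      have : (0 : ℝ) ≤ n := by exact_mod_cast h
      have := mul_nonneg this Real.pi_pos.le
      linarith
    have hn1 : (n : ℝ) ≤ -1 := by exact_mod_cast (by omega : n ≤ -1)
    have : (n : ℝ) * Real.pi ≤ -1 * Real.pi := mul_le_mul_of_nonneg_right hn1 Real.pi_pos.le
    split_ifs at h1 with h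
    · linarith
    · have : ¬ (0 ≤ (auxg c lam θ).arg) := fun h' => h (by linarith [hi.1 h'])
      linarith

lemma aux_deriv (c lam θ : ℝ) (hc : 0 < c) (hlam : 0 < lam) :
    ∃ d, 0 < d ∧ HasDerivAt (fun θ : ℝ => phi c lam θ) d θ := by
  have hfun : (fun θ : ℝ => phi c lam θ) =
      fun θ => θ + Real.pi + (Complex.log (auxg c lam θ)).im := by
    funext t; rw [aux_phi c lam t hc hlam, Complex.log_im]
  have hs := auxg_slit c lam θ hc hlam
  have hC := Real.hasDerivAt_cos θ
  have hS := Real.hasDerivAt_sin θ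
  have hXr := (hC.const_mul c).sub hS
  have hYr := (hS.const_mul c).add (hXr.const_mul lam)
  have hg := ((hXr.ofReal_comp.add (hYr.ofReal_comp.mul_const Complex.I)).neg).mul
    (hC.ofReal_comp.sub (hS.ofReal_comp.mul_const Complex.I))
  have hg' : HasDerivAt (auxg c lam) _ θ := hg
  have hl := hg'.clog_real hs
  have him := (Complex.imCLM.hasFDerivAt.comp_hasDerivAt θ hl)
  have htot := ((hasDerivAt_id θ).add_const Real.pi).add him
  rw [hfun]
  refine ⟨_, ?_, htot⟩
  have hne := Complex.slitPlane_ne_zero hs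
  have hN : 0 < Complex.normSq (auxg c lam θ) := Complex.normSq_pos.2 hne
  have ha := Real.sin_sq_add_cos_sq θ
  have hN' := Complex.normSq_apply (auxg c lam θ)
  rw [auxg_re, auxg_im] at hN'
  rw [Complex.imCLM_apply, Complex.div_im, auxg_re, auxg_im]
  generalize Complex.normSq (auxg c lam θ) = N at *
  have key : ∀ p q : ℝ, 0 < N + p - q → 0 < 1 + (p / N - q / N) := by
    intro p q h
    have : 1 + (p / N - q / N) = (N + p - q) / N := by field_simp; ring
    rw [this]; positivity
  apply key
  simp only [Complex.mul_im, Complex.neg_re, Complex.neg_im, Complex.add_re, Complex.add_im,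
    Complex.sub_re, Complex.sub_im, Complex.ofReal_re, Complex.ofReal_im, Complex.mul_re,
    Complex.I_re, Complex.I_im, Pi.add_apply, Pi.neg_apply, Pi.sub_apply]
  rw [hN']
  generalize Real.sin θ = y at *
  generalize Real.cos θ = x at *
  have h0 : 0 < c ^ 2 * (y ^ 2 + x ^ 2) ^ 2 := by rw [ha]; positivity
  refine lt_of_lt_of_eq h0 ?_
  ring

theorem phi_continuous_strictMono_in_theta (c lam : ℝ) (hc : 0 < c) (hlam : 0 < lam) :
    Continuous (fun θ : ℝ => phi c lam θ) ∧ StrictMono (fun θ : ℝ => phi c lam θ) := by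
  choose d hd hd' using fun θ => aux_deriv c lam θ hc hlam
  refine ⟨continuous_iff_continuousAt.2 fun θ => (hd' θ).continuousAt, ?_⟩
  apply strictMono_of_deriv_pos
  intro θ
  rw [(hd' θ).deriv]
  exact hd θ
end

section
/- For every c > 0, the map (λ,θ) ↦ φ(c,λ,θ) is jointly continuous on (0,∞) × ℝ. -/
open OnePoint

/-- complex number whose argument is the angle of the first shear -/
noncomputable def zA (c θ : ℝ) : ℂ :=
  ⟨1 - Real.sin θ * Real.cos θ / c, Real.sin θ ^ 2 / c⟩

/-- complex number whose argument is the angle of the second shear -/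
noncomputable def zB (lam θ : ℝ) : ℂ :=
  ⟨1 + lam * (Real.sin θ * Real.cos θ), lam * Real.cos θ ^ 2⟩

/-- the explicit lift -/
noncomputable def liftF (c lam θ : ℝ) : ℝ :=
  (θ + (zA c θ).arg) + (zB lam (θ + (zA c θ).arg)).arg

lemma zA_slit {c : ℝ} (hc : 0 < c) (θ : ℝ) : zA c θ ∈ Complex.slitPlane := by
  rw [Complex.mem_slitPlane_iff]
  by_cases h : Real.sin θ = 0
  · left; simp [zA, h]
  · right; simp only [zA]; positivity

lemma zB_slit {lam : ℝ} (hl : 0 < lam) (θ : ℝ) : zB lam θ ∈ Complex.slitPlane := by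
  rw [Complex.mem_slitPlane_iff]
  by_cases h : Real.cos θ = 0
  · left; simp [zB, h]
  · right; simp only [zB]; positivity

lemma rot_cos (θ : ℝ) (z : ℂ) :
    ‖z‖ * Real.cos (θ + z.arg) = Real.cos θ * z.re - Real.sin θ * z.im := by
  rw [Real.cos_add, ← Complex.norm_mul_cos_arg z, ← Complex.norm_mul_sin_arg z]
  simp only [Complex.norm_mul_cos_arg, Complex.norm_mul_sin_arg]
  linear_combination Real.cos θ * Complex.norm_mul_cos_arg z - Real.sin θ * Complex.norm_mul_sin_arg z

lemma rot_sin (θ : ℝ) (z : ℂ) :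
    ‖z‖ * Real.sin (θ + z.arg) = Real.sin θ * z.re + Real.cos θ * z.im := by
  rw [Real.sin_add]
  linear_combination Real.sin θ * Complex.norm_mul_cos_arg z + Real.cos θ * Complex.norm_mul_sin_arg z

lemma liftF_dir {c lam : ℝ} (hc : 0 < c) (hl : 0 < lam) (θ : ℝ) :
    ∃ r : ℝ, 0 < r ∧ r * Real.cos (liftF c lam θ) = Real.cos θ - Real.sin θ / c ∧
      r * Real.sin (liftF c lam θ) =
        Real.sin θ + lam * (Real.cos θ - Real.sin θ / c) := by
  set ψ := θ + (zA c θ).arg with hψ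
  have hF : liftF c lam θ = ψ + (zB lam ψ).arg := rfl
  have a1 := rot_cos θ (zA c θ)
  have a2 := rot_sin θ (zA c θ)
  have b1 := rot_cos ψ (zB lam ψ)
  have b2 := rot_sin ψ (zB lam ψ)
  have pA : 0 < ‖zA c θ‖ := norm_pos_iff.2 (Complex.slitPlane_ne_zero (zA_slit hc θ))
  have pB : 0 < ‖zB lam ψ‖ := norm_pos_iff.2 (Complex.slitPlane_ne_zero (zB_slit hl ψ))
  rw [← hψ] at a1 a2
  rw [← hF] at b1 b2
  generalize ‖zA c θ‖ = r1 at *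
  generalize ‖zB lam ψ‖ = r2 at *
  simp only [zA, zB] at a1 a2 b1 b2
  have e1 := Real.sin_sq_add_cos_sq θ
  have e2 := Real.sin_sq_add_cos_sq ψ
  have a1' : r1 * Real.cos ψ = Real.cos θ - Real.sin θ / c := by
    rw [a1]; linear_combination (-Real.sin θ / c) * e1
  have a2' : r1 * Real.sin ψ = Real.sin θ := by
    rw [a2]; ring
  have b1' : r2 * Real.cos (liftF c lam θ) = Real.cos ψ := by
    rw [b1]; ring
  have b2' : r2 * Real.sin (liftF c lam θ) = Real.sin ψ + lam * Real.cos ψ := by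
    rw [b2]; linear_combination (lam * Real.cos ψ) * e2
  refine ⟨r1 * r2, by positivity, ?_, ?_⟩
  · rw [mul_assoc, b1', a1']
  · rw [mul_assoc, b2', mul_add, a2', ← a1']; ring

lemma arg_range {z : ℂ} (hz : z ∈ Complex.slitPlane) (h : 0 ≤ z.im) :
    0 ≤ z.arg ∧ z.arg < Real.pi :=
  ⟨Complex.arg_nonneg_iff.2 h,
    lt_of_le_of_ne (Complex.arg_le_pi z) (Complex.slitPlane_arg_ne_pi hz)⟩

lemma liftF_range {c lam : ℝ} (hc : 0 < c) (hl : 0 < lam) (θ : ℝ) :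
    0 < liftF c lam θ - θ ∧ liftF c lam θ - θ < 2 * Real.pi := by
  set ψ := θ + (zA c θ).arg with hψ
  have hF : liftF c lam θ = ψ + (zB lam ψ).arg := rfl
  have hA := arg_range (zA_slit hc θ) (by simp only [zA]; positivity)
  have hB := arg_range (zB_slit hl ψ) (by simp only [zB]; positivity)
  refine ⟨?_, by linarith⟩
  by_contra hcon
  have h1 : (zA c θ).arg = 0 := by linarith
  have h2 : (zB lam ψ).arg = 0 := by linarith
  have h3 : ψ = θ := by rw [hψ, h1, add_zero]
  have i1 := (Complex.arg_eq_zero_iff.1 h1).2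
  have i2 := (Complex.arg_eq_zero_iff.1 h2).2
  rw [h3] at i2
  simp only [zA, zB] at i1 i2
  have j1 : Real.sin θ ^ 2 = 0 := by
    rcases div_eq_zero_iff.1 i1 with h | h
    · exact h
    · exact absurd h hc.ne'
  have j2 : Real.cos θ ^ 2 = 0 := by
    rcases mul_eq_zero.1 i2 with h | h
    · exact absurd h hl.ne'
    · exact h
  have := Real.sin_sq_add_cos_sq θ
  linarith

lemma tan_eq_iff {c : ℝ} (hc : 0 < c) (lam θ θ' : ℝ) :
    Tan θ' = Xi c lam (Tan θ) ↔
      Real.sin θ' * (Real.cos θ - Real.sin θ / c) =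
        Real.cos θ' * (Real.sin θ + lam * (Real.cos θ - Real.sin θ / c)) := by
  have hs : ∀ t : ℝ, Real.cos t = 0 → Real.sin t ≠ 0 := by
    intro t h h'
    have := Real.sin_sq_add_cos_sq t
    rw [h, h'] at this; norm_num at this
  -- general comparison with a finite value
  have key : ∀ v : ℝ, ∀ X Y : ℝ, X ≠ 0 → Y = v * X →
      (Tan θ' = (v : OnePoint ℝ) ↔ Real.sin θ' * X = Real.cos θ' * Y) := by
    intro v X Y hX hY
    subst hY
    unfold Tan
    split_ifs with h
    · simp [h, hX, hs θ' h]
    · rw [OnePoint.coe_eq_coe, Real.tan_eq_sin_div_cos, div_eq_iff h]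
      constructor
      · intro e; rw [e]; ring
      · intro e
        apply mul_right_cancel₀ hX
        rw [e]; ring
  by_cases h : Real.cos θ = 0
  · have hT : Tan θ = ∞ := by simp [Tan, h]
    have hX : Xi c lam (Tan θ) = ((lam - c : ℝ) : OnePoint ℝ) := by rw [hT]; rfl
    rw [hX]
    have := hs θ h
    apply key
    · rw [h]; simp [this, hc.ne']
    · rw [h]; field_simp; ring
  · have hT : Tan θ = (Real.tan θ : OnePoint ℝ) := by simp [Tan, h]
    have hX : Xi c lam (Tan θ) = if Real.tan θ = c then ∞ else
      ((Real.tan θ / (1 - Real.tan θ / c) + lam : ℝ) : OnePoint ℝ) := by rw [hT]; rfl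
    rw [hX]
    have ht : Real.sin θ = Real.tan θ * Real.cos θ := (Real.tan_mul_cos h).symm
    split_ifs with hb
    · rw [ht, hb]
      have : Real.cos θ - c * Real.cos θ / c = 0 := by field_simp; ring
      rw [this]
      unfold Tan
      split_ifs with h'
      · simp [h']
      · simp [h', h, hc.ne']
    · have hb' : c - Real.tan θ ≠ 0 := fun e => hb (by linarith)
      have e1 : 1 - Real.tan θ / c ≠ 0 := by
        intro e; apply hb'; field_simp at e; linarith
      have e2 : Real.cos θ - Real.sin θ / c = Real.cos θ * (1 - Real.tan θ / c) := by
        rw [ht]; ring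
      rw [e2]
      apply key
      · exact mul_ne_zero h e1
      · rw [add_mul, ht]
        have : Real.tan θ / (1 - Real.tan θ / c) * (Real.cos θ * (1 - Real.tan θ / c))
          = Real.tan θ * Real.cos θ := by
          rw [mul_comm (Real.cos θ), ← mul_assoc, div_mul_cancel₀ _ e1]
        rw [this]

lemma mem_Iset {c lam : ℝ} (hl : 0 < lam) (b : ℝ) :
    b ∈ Iset lam c ↔ b ^ 2 - lam * b + lam * c ≤ 0 := by
  unfold Iset
  split_ifs with h
  · have hD : 0 ≤ lam ^ 2 - 4 * lam * c := by nlinarith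
    rw [Set.mem_Icc]
    have : (b ^ 2 - lam * b + lam * c ≤ 0) ↔ |2 * b - lam| ≤ Real.sqrt (lam ^ 2 - 4 * lam * c) := by
      rw [Real.le_sqrt (abs_nonneg _) hD, sq_abs]
      constructor <;> intro h <;> linarith
    rw [this, abs_le]
    constructor <;> rintro ⟨h1, h2⟩ <;> constructor <;> linarith
  · simp only [Set.mem_empty_iff_false, false_iff, not_le]
    nlinarith [sq_nonneg (2 * b - lam), mul_pos hl (sub_pos.2 (not_le.1 h))]

lemma indI_eq {c lam : ℝ} (hl : 0 < lam) (θ : ℝ) :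
    indI lam c (Tan θ) =
      if Real.sin θ ^ 2 - lam * Real.sin θ * Real.cos θ + lam * c * Real.cos θ ^ 2 ≤ 0
        then 1 else 0 := by
  by_cases h : Real.cos θ = 0
  · have hT : Tan θ = ∞ := by simp [Tan, h]
    have : indI lam c (Tan θ) = 0 := by rw [hT]; rfl
    rw [this, if_neg]
    have := Real.sin_sq_add_cos_sq θ
    rw [h] at this ⊢
    nlinarith
  · have hT : Tan θ = (Real.tan θ : OnePoint ℝ) := by simp [Tan, h]
    have : indI lam c (Tan θ) = (Iset lam c).indicator (fun _ => (1 : ℝ)) (Real.tan θ) := by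
      rw [hT]; rfl
    classical
    rw [this, Set.indicator_apply]
    have ht : Real.sin θ = Real.tan θ * Real.cos θ := (Real.tan_mul_cos h).symm
    have e : Real.sin θ ^ 2 - lam * Real.sin θ * Real.cos θ + lam * c * Real.cos θ ^ 2
        = Real.cos θ ^ 2 * (Real.tan θ ^ 2 - lam * Real.tan θ + lam * c) := by
      rw [ht]; ring
    have hp : 0 < Real.cos θ ^ 2 := by positivity
    have hiff : Real.cos θ ^ 2 * (Real.tan θ ^ 2 - lam * Real.tan θ + lam * c) ≤ 0 ↔
        Real.tan θ ^ 2 - lam * Real.tan θ + lam * c ≤ 0 := by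
      constructor
      · intro h1
        by_contra h2
        have := mul_pos hp (not_le.1 h2)
        linarith
      · exact fun h1 => mul_nonpos_of_nonneg_of_nonpos hp.le h1
    rw [e]
    simp only [mem_Iset hl, hiff]

lemma phi_eq {c lam : ℝ} (hc : 0 < c) (hl : 0 < lam) (θ : ℝ) :
    phi c lam θ = liftF c lam θ := by
  obtain ⟨r, hr, h1, h2⟩ := liftF_dir hc hl θ
  obtain ⟨g1, g2⟩ := liftF_range hc hl θ
  set F := liftF c lam θ with hF
  have hset : ∀ θ', Tan θ' = Xi c lam (Tan θ) ↔ Real.sin (θ' - F) = 0 := by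
    intro θ'
    rw [tan_eq_iff hc, ← h2, ← h1, Real.sin_sub]
    constructor
    · intro e
      apply mul_left_cancel₀ hr.ne'
      linear_combination e
    · intro e; linear_combination r * e
  have hsin : r * c * Real.sin (F - θ) =
      Real.sin θ ^ 2 - lam * Real.sin θ * Real.cos θ + lam * c * Real.cos θ ^ 2 := by
    have h1' : c * (r * Real.cos F) = c * Real.cos θ - Real.sin θ := by
      rw [h1]; field_simp
    have h2' : c * (r * Real.sin F) = c * Real.sin θ + lam * (c * Real.cos θ - Real.sin θ) := by
      rw [h2]; field_simp
    rw [Real.sin_sub]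
    linear_combination Real.cos θ * h2' - Real.sin θ * h1'
  have hpi := Real.pi_pos
  have hbd : θ + Real.pi * indI lam c (Tan θ) ≤ F ∧
      F < θ + Real.pi * indI lam c (Tan θ) + Real.pi := by
    rw [indI_eq hl, ← hsin]
    have hrc : 0 < r * c := by positivity
    split_ifs with hq
    · have hs : Real.sin (F - θ) ≤ 0 := by
        by_contra hh
        have := mul_pos hrc (not_le.1 hh)
        linarith
      refine ⟨?_, by linarith⟩
      by_contra hh
      have := Real.sin_pos_of_pos_of_lt_pi g1 (by linarith)
      linarith
    · refine ⟨by linarith, ?_⟩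
      by_contra hh
      apply hq
      apply mul_nonpos_of_nonneg_of_nonpos hrc.le
      have := Real.sin_nonneg_of_nonneg_of_le_pi (x := F - θ - Real.pi) (by linarith) (by linarith)
      rw [Real.sin_sub_pi] at this
      linarith
  have hleast : IsLeast {θ' : ℝ | θ + Real.pi * indI lam c (Tan θ) ≤ θ' ∧
      Tan θ' = Xi c lam (Tan θ)} F := by
    refine ⟨⟨hbd.1, (hset F).2 (by simp)⟩, ?_⟩
    rintro θ' ⟨k1, k2⟩
    obtain ⟨n, hn⟩ := Real.sin_eq_zero_iff.1 ((hset θ').1 k2)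
    have hn' : (-1 : ℝ) < n := by
      by_contra hh
      have : (n : ℝ) * Real.pi ≤ (-1) * Real.pi :=
        mul_le_mul_of_nonneg_right (not_lt.1 hh) hpi.le
      linarith
    have hn0 : 0 ≤ n := by
      have : (-1 : ℤ) < n := by exact_mod_cast hn'
      omega
    have : 0 ≤ (n : ℝ) * Real.pi := mul_nonneg (by exact_mod_cast hn0) hpi.le
    linarith
  exact hleast.csInf_eq

lemma continuous_mk' {α : Type*} [TopologicalSpace α] {f g : α → ℝ} (hf : Continuous f)
    (hg : Continuous g) : Continuous (fun a => (⟨f a, g a⟩ : ℂ)) := by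
  have : (fun a => (⟨f a, g a⟩ : ℂ)) = fun a => ((f a : ℂ) + (g a : ℂ) * Complex.I) := by
    funext a; exact Complex.mk_eq_add_mul_I _ _
  rw [this]
  fun_prop

/-- For fixed `c > 0`, the map `(λ,θ) ↦ φ(c,λ,θ)` is jointly continuous on `(0,∞) × ℝ`. -/
theorem phi_jointly_continuous (c : ℝ) (hc : 0 < c) :
    ContinuousOn (fun p : ℝ × ℝ => phi c p.1 p.2) (Set.Ioi (0 : ℝ) ×ˢ Set.univ) := by
  have hA : Continuous (fun θ : ℝ => θ + (zA c θ).arg) := by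
    have hz : Continuous (fun θ : ℝ => zA c θ) := by
      apply continuous_mk' <;> fun_prop
    refine continuous_id.add (continuous_iff_continuousAt.2 fun θ => ?_)
    exact ContinuousAt.comp (f := fun θ => zA c θ) (Complex.continuousAt_arg (zA_slit hc θ))
      hz.continuousAt
  have hB : Continuous (fun p : ℝ × ℝ => zB p.1 (p.2 + (zA c p.2).arg)) := by
    have hA2 := hA.comp (continuous_snd (X := ℝ) (Y := ℝ))
    have hs := Real.continuous_sin.comp hA2
    have hk := Real.continuous_cos.comp hA2
    exact continuous_mk' (continuous_const.add (continuous_fst.mul (hs.mul hk)))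
      (continuous_fst.mul (hk.pow 2))
  have hF : ContinuousOn (fun p : ℝ × ℝ => liftF c p.1 p.2) (Set.Ioi (0 : ℝ) ×ˢ Set.univ) := by
    rintro p ⟨hp, -⟩
    apply ContinuousAt.continuousWithinAt
    refine ContinuousAt.add (hA.comp continuous_snd).continuousAt ?_
    exact ContinuousAt.comp (f := fun p : ℝ × ℝ => zB p.1 (p.2 + (zA c p.2).arg))
      (Complex.continuousAt_arg (zB_slit hp _)) hB.continuousAt
  refine hF.congr ?_
  rintro p ⟨hp, -⟩
  exact phi_eq hc hp p.2
end

section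
/- Let N ≥ 2, let c : {1,…,N−1} → (0,∞) be conductances, let k ∈ {1,…,N−1} and let λ > 0 satisfy θ(λ,N+1) = k·π. Suppose that for each i ∈ {1,…,k−1}, x_i ∈ {1,…,N} satisfies θ(λ,x_i) ≤ i·π < θ(λ,x_i+1). Then 2 ≤ x_i ≤ N−1 for every i, and the points x_1, …, x_{k−1} are pairwise distinct. -/
open OnePoint

/-- The angle sequence `θ(λ, x)`, `1 ≤ x ≤ N+1`: `θ(λ,1) = 0`, `θ(λ,2) = arctan λ`,
and `θ(λ,x+1) = φ(c(x−1), λ, θ(λ,x))` for `2 ≤ x ≤ N`. -/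
noncomputable def thetaSeq (c : ℕ → ℝ) (lam : ℝ) : ℕ → ℝ
  | 0 => 0
  | 1 => 0
  | 2 => Real.arctan lam
  | x + 3 => phi (c (x + 1)) lam (thetaSeq c lam (x + 2))

lemma Tan_add_int (a : ℝ) (n : ℤ) : Tan (a + n * Real.pi) = Tan a := by
  unfold Tan
  have h : Real.cos (a + n * Real.pi) = 0 ↔ Real.cos a = 0 := by
    rw [Real.cos_add_int_mul_pi]
    constructor
    · intro h
      rcases mul_eq_zero.1 h with h | h
      · exact absurd h (zpow_ne_zero _ (by norm_num))
      · exact h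
    · intro h; rw [h, mul_zero]
  simp only [h, Real.tan_add_int_mul_pi]

lemma Tan_arctan (b : ℝ) : Tan (Real.arctan b) = (b : OnePoint ℝ) := by
  unfold Tan
  rw [if_neg (Real.cos_arctan_pos b).ne', Real.tan_arctan]

lemma Tan_pi_half : Tan (Real.pi / 2) = ∞ := by
  unfold Tan
  rw [if_pos Real.cos_pi_div_two]

lemma Iset_quad {lam c b : ℝ} (hl : 0 < lam) (h : b ∈ Iset lam c) :
    b ^ 2 + lam * c ≤ lam * b := by
  unfold Iset at h
  split_ifs at h with h4
  · obtain ⟨h1, h2⟩ := h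
    have hD : 0 ≤ lam ^ 2 - 4 * lam * c := by nlinarith
    have hs := Real.sq_sqrt hD
    have : (2 * b - lam) ^ 2 ≤ (Real.sqrt (lam ^ 2 - 4 * lam * c)) ^ 2 :=
      sq_le_sq' (by linarith) (by linarith)
    nlinarith
  · exact absurd h (Set.notMem_empty _)

lemma indI_coe_of_mem {lam c b : ℝ} (h : b ∈ Iset lam c) :
    indI lam c (b : OnePoint ℝ) = 1 := by
  change (Iset lam c).indicator (fun _ => (1 : ℝ)) b = 1
  simp [h]

lemma indI_coe_of_notMem {lam c b : ℝ} (h : b ∉ Iset lam c) :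
    indI lam c (b : OnePoint ℝ) = 0 := by
  change (Iset lam c).indicator (fun _ => (1 : ℝ)) b = 0
  simp [h]

lemma indI_infty {lam c : ℝ} : indI lam c ∞ = 0 := rfl

lemma Xi_infty {lam c : ℝ} : Xi c lam ∞ = ((lam - c : ℝ) : OnePoint ℝ) := rfl

lemma Xi_coe_eq {lam c : ℝ} : Xi c lam (c : OnePoint ℝ) = ∞ := by
  change (if c = c then ∞ else _) = (∞ : OnePoint ℝ)
  simp

lemma Xi_coe_ne {lam c b : ℝ} (h : b ≠ c) :
    Xi c lam (b : OnePoint ℝ) = ((b / (1 - b / c) + lam : ℝ) : OnePoint ℝ) := by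
  change (if b = c then ∞ else _) = _
  rw [if_neg h]

lemma phi_le {c lam θ θ' : ℝ} (h1 : θ + Real.pi * indI lam c (Tan θ) ≤ θ')
    (h2 : Tan θ' = Xi c lam (Tan θ)) : phi c lam θ ≤ θ' :=
  csInf_le ⟨_, fun _ h => h.1⟩ ⟨h1, h2⟩

lemma int_le_of {n i : ℤ} {a : ℝ} (ha : -Real.pi < a)
    (h : a + n * Real.pi ≤ i * Real.pi) : n ≤ i := by
  have hp := Real.pi_pos
  have h1 : (n : ℝ) - 1 < i := by
    by_contra hh
    push Not at hh
    nlinarith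
  have h2 : (n : ℝ) < ((i + 1 : ℤ) : ℝ) := by push_cast; linarith
  have := Int.cast_lt.1 h2
  omega

lemma phi_lt {c lam θ : ℝ} (hc : 0 < c) (hl : 0 < lam) {i : ℤ}
    (h : θ ≤ i * Real.pi) : phi c lam θ < (i + 1) * Real.pi := by
  have hp := Real.pi_pos
  obtain ⟨n, a, rfl, ha1, ha2⟩ : ∃ (n : ℤ) (a : ℝ), θ = a + n * Real.pi ∧
      -(Real.pi / 2) < a ∧ a ≤ Real.pi / 2 := by
    refine ⟨⌈θ / Real.pi - 1 / 2⌉, θ - ⌈θ / Real.pi - 1 / 2⌉ * Real.pi, by ring, ?_, ?_⟩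
    · have := Int.ceil_lt_add_one (θ / Real.pi - 1 / 2)
      have h2 := mul_lt_mul_of_pos_right this hp
      have h3 : (θ / Real.pi - 1 / 2 + 1) * Real.pi = θ + Real.pi / 2 := by field_simp; ring
      linarith
    · have := Int.le_ceil (θ / Real.pi - 1 / 2)
      have h2 := mul_le_mul_of_nonneg_right this hp.le
      have h3 : (θ / Real.pi - 1 / 2) * Real.pi = θ - Real.pi / 2 := by field_simp
      linarith
  have hT := Tan_add_int a n
  have hni : (n : ℝ) * Real.pi ≤ i * Real.pi :=
    mul_le_mul_of_nonneg_right (by exact_mod_cast int_le_of (by linarith) h) hp.le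
  have hni' : 0 < a → ((n : ℝ) + 1) * Real.pi ≤ i * Real.pi := by
    intro h0
    refine mul_le_mul_of_nonneg_right ?_ hp.le
    have : n + 1 ≤ i := int_le_of (a := a - Real.pi) (by linarith) (by push_cast; linarith)
    exact_mod_cast this
  rcases ha2.eq_or_lt with rfl | ha2
  · rw [Tan_pi_half] at hT
    have := hni' (by linarith)
    have l1 := Real.neg_pi_div_two_lt_arctan (lam - c)
    have l2 := Real.arctan_lt_pi_div_two (lam - c)
    refine lt_of_le_of_lt (phi_le (θ' := Real.arctan (lam - c) + (n + 1 : ℤ) * Real.pi) ?_ ?_) ?_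
    · rw [hT, indI_infty]; push_cast; linarith
    · rw [hT, Xi_infty, Tan_add_int, Tan_arctan]
    · push_cast; linarith
  obtain ⟨b, rfl⟩ : ∃ b, a = Real.arctan b :=
    ⟨Real.tan a, (Real.arctan_tan ha1 ha2).symm⟩
  rw [Tan_arctan] at hT
  have l1 := Real.neg_pi_div_two_lt_arctan (b / (1 - b / c) + lam)
  have l2 := Real.arctan_lt_pi_div_two (b / (1 - b / c) + lam)
  rcases le_or_gt b 0 with hb | hb
  · have hbI : b ∉ Iset lam c := by
      intro hm
      have := Iset_quad hl hm
      nlinarith [mul_pos hl hc, sq_nonneg b]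
    have hbc : b ≠ c := by linarith
    refine lt_of_le_of_lt (phi_le
      (θ' := Real.arctan (b / (1 - b / c) + lam) + n * Real.pi) ?_ ?_) ?_
    · rw [hT, indI_coe_of_notMem hbI]
      have : Real.arctan b ≤ Real.arctan (b / (1 - b / c) + lam) := by
        apply Real.arctan_strictMono.monotone
        have hd : b / c ≤ 0 := div_nonpos_of_nonpos_of_nonneg hb hc.le
        have : b ≤ b / (1 - b / c) := by
          rw [le_div_iff₀ (by linarith)]
          nlinarith
        linarith
      linarith
    · rw [hT, Xi_coe_ne hbc, Tan_add_int, Tan_arctan]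
    · linarith
  have hn := hni' (Real.arctan_pos.2 hb)
  by_cases hbc : b = c
  · subst hbc
    have hbI : b ∉ Iset lam b := by
      intro hm
      have := Iset_quad hl hm
      nlinarith
    refine lt_of_le_of_lt (phi_le (θ' := Real.pi / 2 + n * Real.pi) ?_ ?_) ?_
    · rw [hT, indI_coe_of_notMem hbI]; linarith
    · rw [hT, Xi_coe_eq, Tan_add_int, Tan_pi_half]
    · linarith
  refine lt_of_le_of_lt (phi_le
    (θ' := Real.arctan (b / (1 - b / c) + lam) + (n + 1 : ℤ) * Real.pi) ?_ ?_) ?_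
  · by_cases hm : b ∈ Iset lam c
    · rw [hT, indI_coe_of_mem hm]
      have hq := Iset_quad hl hm
      have hcb : c < b := by
        by_contra hh
        push Not at hh
        nlinarith [mul_le_mul_of_nonneg_left hh hl.le]
      have : Real.arctan b ≤ Real.arctan (b / (1 - b / c) + lam) := by
        apply Real.arctan_strictMono.monotone
        have e : b / (1 - b / c) = - (b * c / (b - c)) := by
          have h1 : c - b ≠ 0 := by linarith
          have h2 : b - c ≠ 0 := by linarith
          have h3 : 1 - b / c = -((b - c) / c) := by field_simp; ring
          rw [h3, div_neg, div_div_eq_mul_div]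
        rw [e]
        have : b * c / (b - c) ≤ lam - b := by
          rw [div_le_iff₀ (by linarith)]
          nlinarith
        linarith
      push_cast; linarith
    · rw [hT, indI_coe_of_notMem hm]
      push_cast; linarith
  · rw [hT, Xi_coe_ne hbc, Tan_add_int, Tan_arctan]
  · push_cast; linarith

lemma thetaSeq_step {N : ℕ} {c : ℕ → ℝ} (hc : ∀ y, 1 ≤ y → y ≤ N - 1 → 0 < c y)
    {lam : ℝ} (hl : 0 < lam) {y : ℕ} (h1 : 1 ≤ y) (hN : y ≤ N) {i : ℕ}
    (h : thetaSeq c lam y ≤ i * Real.pi) : thetaSeq c lam (y + 1) < (i + 1) * Real.pi := by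
  match y, h1, hN, h with
  | 1, _, _, _ =>
    have : thetaSeq c lam (1 + 1) = Real.arctan lam := rfl
    rw [this]
    have hp := Real.pi_pos
    have := Real.arctan_lt_pi_div_two lam
    have : (0 : ℝ) ≤ i * Real.pi := by positivity
    linarith
  | z + 2, _, hN, h =>
    have e : thetaSeq c lam (z + 2 + 1) = phi (c (z + 1)) lam (thetaSeq c lam (z + 2)) := rfl
    rw [e]
    have := phi_lt (hc (z + 1) (by omega) (by omega)) hl (i := (i : ℤ)) (by exact_mod_cast h)
    exact_mod_cast this

/-- If `θ(λ,N+1) = kπ` and `x_i` satisfies `θ(λ,x_i) ≤ iπ < θ(λ,x_i+1)` for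
`1 ≤ i ≤ k−1`, then `2 ≤ x_i ≤ N−1` and the `x_i` are pairwise distinct. -/
theorem crossing_points_distinct (N : ℕ) (hN : 2 ≤ N) (c : ℕ → ℝ)
    (hc : ∀ y, 1 ≤ y → y ≤ N - 1 → 0 < c y)
    (k : ℕ) (hk : 1 ≤ k) (hk' : k ≤ N - 1)
    (lam : ℝ) (hlam : 0 < lam)
    (hθN : thetaSeq c lam (N + 1) = (k : ℝ) * Real.pi)
    (x : ℕ → ℕ)
    (hx1 : ∀ i, 1 ≤ i → i ≤ k - 1 → 1 ≤ x i ∧ x i ≤ N)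
    (hx2 : ∀ i, 1 ≤ i → i ≤ k - 1 → thetaSeq c lam (x i) ≤ (i : ℝ) * Real.pi)
    (hx3 : ∀ i, 1 ≤ i → i ≤ k - 1 → (i : ℝ) * Real.pi < thetaSeq c lam (x i + 1)) :
    (∀ i, 1 ≤ i → i ≤ k - 1 → 2 ≤ x i ∧ x i ≤ N - 1) ∧
    (∀ i j, 1 ≤ i → i < j → j ≤ k - 1 → x i ≠ x j) := by
  have hp := Real.pi_pos
  have key : ∀ i, 1 ≤ i → i ≤ k - 1 →
      thetaSeq c lam (x i + 1) < ((i : ℝ) + 1) * Real.pi := fun i h1 h2 =>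
    thetaSeq_step hc hlam (hx1 i h1 h2).1 (hx1 i h1 h2).2 (hx2 i h1 h2)
  refine ⟨fun i h1 h2 => ⟨?_, ?_⟩, fun i j h1 hij h2 he => ?_⟩
  · by_contra hh
    have h := hx1 i h1 h2
    have e : x i = 1 := by omega
    have h3 := hx3 i h1 h2
    have e2 : thetaSeq c lam (1 + 1) = Real.arctan lam := rfl
    rw [e, e2] at h3
    have := Real.arctan_lt_pi_div_two lam
    have : (1 : ℝ) ≤ i := by exact_mod_cast h1
    nlinarith
  · by_contra hh
    have h := hx1 i h1 h2
    have e : x i = N := by omega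
    have h3 := key i h1 h2
    rw [e, hθN] at h3
    have : (i : ℝ) + 1 ≤ k := by exact_mod_cast (by omega : i + 1 ≤ k)
    nlinarith
  · have h3 := key i h1 (by omega)
    have h4 := hx3 j (by omega) h2
    rw [he] at h3
    have : (i : ℝ) + 1 ≤ j := by exact_mod_cast hij
    nlinarith
end

section
/- Let (r^(N))_{N≥2} be a family of resistances satisfying condition (LLN), and let α > 0. Then for every ε ∈ (0, π/2), lim_{N→∞} sup { |B^(N)(max(⌈u·N⌉,1)) − √α·tan(√α·u)| : u ∈ [0, min(1, (π/2 − ε)/√α)] } = 0. -/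
/-- `rsum r n m = Σ_{x=n}^{m-1} r(x)`. -/
def rsum (r : ℕ → ℝ) (n m : ℕ) : ℝ := ∑ x ∈ Finset.Ico n m, r x

/-- Condition (LLN): `(1/N)·sup_{1 ≤ n < m ≤ N} |r^{(N)}(n,m) − (m−n)| → 0`. -/
def LLN (r : ℕ → ℕ → ℝ) : Prop :=
  ∀ ε > (0 : ℝ), ∃ N₀ : ℕ, ∀ N ≥ N₀, ∀ n m : ℕ, 1 ≤ n → n < m → m ≤ N →
    |rsum (r N) n m - ((m : ℝ) - (n : ℝ))| ≤ ε * N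

/-- The sequence `B^{(N)}`: `B(1) = 0` and
`B(x+1) = B(x)/(1 − N⁻¹·r(x−1)·B(x)) + α/N` (so `B(2) = α/N`). -/
noncomputable def Bseq (N : ℕ) (r : ℕ → ℝ) (α : ℝ) : ℕ → ℝ
  | 0 => 0
  | 1 => 0
  | x + 2 => Bseq N r α (x + 1) / (1 - (N : ℝ)⁻¹ * r x * Bseq N r α (x + 1)) + α / N

/-- linearised pair `(C, S)`. -/
noncomputable def CS (h α : ℝ) (q : ℕ → ℝ) : ℕ → ℝ × ℝ
  | 0 => (1, 0)
  | k + 1 => ((CS h α q k).1 - h * q k * (CS h α q k).2,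
      (CS h α q k).2 + α * h * ((CS h α q k).1 - h * q k * (CS h α q k).2))

lemma small_trig (y : ℝ) (h0 : 0 < y) (h1 : y ≤ 1) (p q : ℝ) (hp : |p| ≤ 1) (hq : |q| ≤ 1) :
    |p * (1 - Real.cos y) + q * (Real.sin y - y)| ≤ y ^ 2 := by
  have e1 := Real.one_sub_sq_div_two_le_cos (x := y)
  have e2 := Real.cos_le_one y
  have e3 := Real.sin_gt_sub_cube h0
  have e4 := Real.sin_lt h0
  have a1 : |1 - Real.cos y| ≤ y ^ 2 / 2 := by rw [abs_le]; constructor <;> nlinarith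
  have a2 : |Real.sin y - y| ≤ y ^ 2 / 2 := by
    have : y ^ 3 ≤ y ^ 2 := by nlinarith [sq_nonneg y]
    rw [abs_le]; constructor <;> nlinarith [sq_nonneg y]
  calc _ ≤ |p * (1 - Real.cos y)| + |q * (Real.sin y - y)| := abs_add_le _ _
    _ = |p| * |1 - Real.cos y| + |q| * |Real.sin y - y| := by rw [abs_mul, abs_mul]
    _ ≤ 1 * (y ^ 2 / 2) + 1 * (y ^ 2 / 2) := by gcongr
    _ = y ^ 2 := by ring

set_option maxHeartbeats 2000000 in
lemma gron (h a δ : ℝ) (hh : 0 < h) (ha : 0 < a) (hδ : 0 ≤ δ) (hah : a * h ≤ 1)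
    (q : ℕ → ℝ) (n : ℕ) (hq : ∀ k < n, 0 ≤ q k) (e : ℕ → ℝ) (he0 : e 0 = 0)
    (he : ∀ k, e (k + 1) = e k + h * (q k - 1)) (heb : ∀ k ≤ n, |e k| ≤ δ) :
    ∀ k ≤ n,
      |(CS h (a ^ 2) q k).1 - Real.cos (a * h * k) + e k * (a * Real.sin (a * h * k))|
       + |(CS h (a ^ 2) q k).2 - a * Real.sin (a * h * k)|
      ≤ Real.exp (a ^ 2 * h * k + (h * k + e k)) *
        (2 * (a ^ 2 * (h + δ) * (1 + a)) * h * k) := by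
  intro k
  induction k with
  | zero => intro _; simp [CS, he0]
  | succ k ih =>
    intro hk
    have ih := ih (by omega)
    have hqk := hq k (by omega)
    have hek := heb (k + 1) hk
    have hek' := he k
    simp only [CS]
    set C := (CS h (a ^ 2) q k).1
    set S := (CS h (a ^ 2) q k).2
    have hx : a * h * ((k + 1 : ℕ) : ℝ) = a * h * k + a * h := by push_cast; ring
    rw [hx]
    set x := a * h * k with hxd
    have hy : 0 < a * h := by positivity
    set y := a * h with hyd
    have hcx := Real.abs_cos_le_one x
    have hsx := Real.abs_sin_le_one x
    have hcx' := Real.abs_cos_le_one (x + y)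
    have hsx' := Real.abs_sin_le_one (x + y)
    have t1 : |Real.cos (x + y) - Real.cos x + y * Real.sin x| ≤ y ^ 2 := by
      have := small_trig y hy hah (-Real.cos x) (-Real.sin x) (by rwa [abs_neg]) (by rwa [abs_neg])
      rw [Real.cos_add]
      convert this using 2; ring
    have t2 : |Real.sin (x + y) - Real.sin x - y * Real.cos (x + y)| ≤ y ^ 2 := by
      have := small_trig y hy hah (Real.sin (x + y)) (Real.cos (x + y)) hsx' hcx'
      have e : Real.sin x = Real.sin (x + y) * Real.cos y - Real.cos (x + y) * Real.sin y := by
        rw [← Real.sin_sub]; ring_nf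
      rw [e]
      convert this using 2; ring
    have t3 : |Real.sin (x + y) - Real.sin x| ≤ y := by
      have := Real.abs_sin_sub_sin_le (x + y) x
      rwa [add_sub_cancel_left, abs_of_pos hy] at this
    set c := Real.cos x
    set s := Real.sin x
    set c' := Real.cos (x + y)
    set s' := Real.sin (x + y)
    set κ := a ^ 2 * (h + δ) * (1 + a) with hκ
    have hκ0 : 0 ≤ κ := by positivity
    set D := C - c + e k * (a * s) with hD
    set E := S - a * s with hE
    set D' := C - h * q k * S - c' + e (k + 1) * (a * s') with hD'
    set E' := S + a ^ 2 * h * (C - h * q k * S) - a * s' with hE'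
    have hρ : 0 ≤ h * q k := by positivity
    have b1 : |D'| ≤ |D| + h * q k * |E| + κ * h := by
      have : D' = D + (-(h * q k) * E) + (-(c' - c + y * s)) + e (k + 1) * (a * (s' - s)) := by
        rw [hD', hD, hE, hek', hyd]; ring
      rw [this]
      have u1 : |e (k + 1) * (a * (s' - s))| ≤ δ * (a * y) := by
        rw [abs_mul, abs_mul, abs_of_pos ha]; gcongr
      have u2 : |-(h * q k) * E| = h * q k * |E| := by
        rw [abs_mul, abs_neg, abs_of_nonneg hρ]
      have u3 : y ^ 2 + δ * (a * y) ≤ κ * h := by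
        have : 0 ≤ a ^ 3 * (h + δ) * h := by positivity
        rw [hκ, hyd]; nlinarith
      have v1 := abs_add_le (D + (-(h * q k) * E) + (-(c' - c + y * s))) (e (k + 1) * (a * (s' - s)))
      have v2 := abs_add_le (D + (-(h * q k) * E)) (-(c' - c + y * s))
      have v3 := abs_add_le D (-(h * q k) * E)
      rw [abs_neg] at v2
      linarith
    have b2 : |E'| ≤ |E| + a ^ 2 * h * |D'| + κ * h := by
      have : E' = E + a ^ 2 * h * D' + (-(a ^ 2 * h * (e (k + 1) * (a * s'))))
          + (-(a * (s' - s - y * c'))) := by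
        rw [hE', hD', hE, hyd]; ring
      rw [this]
      have u1 : |a ^ 2 * h * (e (k + 1) * (a * s'))| ≤ a ^ 2 * h * (δ * (a * 1)) := by
        rw [abs_mul, abs_mul (e _), abs_mul a, abs_of_pos ha,
          abs_of_nonneg (show 0 ≤ a ^ 2 * h by positivity)]; gcongr
      have u2 : |a ^ 2 * h * D'| = a ^ 2 * h * |D'| := by
        rw [abs_mul, abs_of_nonneg (show 0 ≤ a ^ 2 * h by positivity)]
      have u4 : |a * (s' - s - y * c')| ≤ a * y ^ 2 := by
        rw [abs_mul, abs_of_pos ha]; gcongr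
      have u3 : a ^ 2 * h * (δ * (a * 1)) + a * y ^ 2 ≤ κ * h := by
        have : 0 ≤ a ^ 2 * (h + δ) * h := by positivity
        rw [hκ, hyd]; nlinarith
      have v1 := abs_add_le (E + a ^ 2 * h * D' + (-(a ^ 2 * h * (e (k + 1) * (a * s')))))
        (-(a * (s' - s - y * c')))
      have v2 := abs_add_le (E + a ^ 2 * h * D') (-(a ^ 2 * h * (e (k + 1) * (a * s'))))
      have v3 := abs_add_le E (a ^ 2 * h * D')
      rw [abs_neg] at v1 v2
      linarith
    have hβ : 0 ≤ a ^ 2 * h := by positivity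
    have hxx : a ^ 2 * h * ((k + 1 : ℕ) : ℝ) + (h * ((k + 1 : ℕ) : ℝ) + e (k + 1))
       = (a ^ 2 * h * k + (h * k + e k)) + (a ^ 2 * h + h * q k) := by
      rw [hek']; push_cast; ring
    rw [hxx]
    set P := a ^ 2 * h * k + (h * k + e k) with hP
    set Q := 2 * κ * h * k with hQ
    have hQ' : 2 * κ * h * ((k + 1 : ℕ) : ℝ) = Q + 2 * (κ * h) := by rw [hQ]; push_cast; ring
    rw [hQ', Real.exp_add P]
    have hP0 : 0 ≤ P := by
      have : ∀ j ≤ n, 0 ≤ h * j + e j := by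
        intro j
        induction j with
        | zero => intro _; simp [he0]
        | succ j ihj =>
          intro hj
          have := ihj (by omega)
          have h3 : 0 ≤ h * q j := mul_nonneg hh.le (hq j (by omega))
          rw [he j]; push_cast; nlinarith
      have := this k (by omega)
      positivity
    have hQ0 : 0 ≤ Q := by positivity
    have hp1 : 1 ≤ Real.exp P := Real.one_le_exp hP0
    have hbig : (1 + a ^ 2 * h) * (1 + h * q k) ≤ Real.exp (a ^ 2 * h + h * q k) := by
      rw [Real.exp_add]
      have w1 := Real.add_one_le_exp (a ^ 2 * h)
      have w2 := Real.add_one_le_exp (h * q k)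
      apply mul_le_mul <;> first | linarith | positivity
    have hT : |D| + |E| ≤ Real.exp P * Q := ih
    have hD0 := abs_nonneg D
    have hE0 := abs_nonneg E
    have hκh : 0 ≤ κ * h := by positivity
    calc |D'| + |E'| ≤ (1 + a ^ 2 * h) * |D'| + |E| + κ * h := by linarith
      _ ≤ (1 + a ^ 2 * h) * (|D| + h * q k * |E| + κ * h) + |E| + κ * h := by gcongr
      _ ≤ (1 + a ^ 2 * h) * (1 + h * q k) * ((|D| + |E|) + 2 * (κ * h)) := by
        have z1 := mul_nonneg hρ hD0
        have z2 := mul_nonneg hβ hE0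
        have z3 := mul_nonneg hβ z1
        have z4 := mul_nonneg hβ hκh
        have z5 := mul_nonneg hρ hκh
        have z6 := mul_nonneg hβ z5
        nlinarith
      _ ≤ (1 + a ^ 2 * h) * (1 + h * q k) * (Real.exp P * Q + Real.exp P * (2 * (κ * h))) := by
        have : 2 * (κ * h) ≤ Real.exp P * (2 * (κ * h)) :=
          le_mul_of_one_le_left (by positivity) hp1
        gcongr
      _ ≤ Real.exp (a ^ 2 * h + h * q k) * (Real.exp P * Q + Real.exp P * (2 * (κ * h))) := by
        gcongr
      _ = _ := by ring

lemma Bseq_eq (N : ℕ) (r q : ℕ → ℝ) (α : ℝ) (hq : ∀ k, 1 ≤ k → q k = r k) :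
    ∀ k, (∀ j ≤ k, (CS (N : ℝ)⁻¹ α q j).1 ≠ 0) →
      Bseq N r α (k + 1) = (CS (N : ℝ)⁻¹ α q k).2 / (CS (N : ℝ)⁻¹ α q k).1 := by
  intro k
  induction k with
  | zero => intro _; simp [Bseq, CS]
  | succ k ih =>
    intro hC
    have ih := ih (fun j hj => hC j (by omega))
    have h1 := hC k (by omega)
    have h2 := hC (k + 1) le_rfl
    simp only [CS] at h2 ⊢
    rw [Bseq, ih]
    have hz : r k * (CS (N : ℝ)⁻¹ α q k).2 = q k * (CS (N : ℝ)⁻¹ α q k).2 := by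
      rcases Nat.eq_zero_or_pos k with rfl | hk
      · simp [CS]
      · rw [hq k hk]
    set C := (CS (N : ℝ)⁻¹ α q k).1
    set S := (CS (N : ℝ)⁻¹ α q k).2
    have h3 : 1 - (N : ℝ)⁻¹ * r k * (S / C) = (C - (N : ℝ)⁻¹ * q k * S) / C := by
      rw [eq_div_iff h1, sub_mul, mul_assoc, mul_assoc, mul_assoc, div_mul_cancel₀ _ h1, hz]; ring
    rw [h3, div_div_div_cancel_right₀ h1, add_div, mul_div_assoc (α * _), div_self h2]
    ring

set_option maxHeartbeats 2000000 in
theorem Bseq_first_segment (r : ℕ → ℕ → ℝ)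
    (hr : ∀ N, 2 ≤ N → ∀ x, 1 ≤ x → x ≤ N - 1 → 0 < r N x)
    (hLLN : LLN r) (α : ℝ) (hα : 0 < α)
    (ε : ℝ) (hε : 0 < ε) (hε' : ε < Real.pi / 2) :
    ∀ η > (0 : ℝ), ∃ N₀ : ℕ, ∀ N ≥ N₀,
      ∀ u ∈ Set.Icc (0 : ℝ) (min 1 ((Real.pi / 2 - ε) / Real.sqrt α)),
        |Bseq N (r N) α (max ⌈u * N⌉₊ 1) -
          Real.sqrt α * Real.tan (Real.sqrt α * u)| < η := by
  intro η hη
  have ha : 0 < Real.sqrt α := Real.sqrt_pos.2 hα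
  have haα : Real.sqrt α ^ 2 = α := Real.sq_sqrt hα.le
  set a := Real.sqrt α
  clear_value a
  subst haα
  set m := Real.sin ε with hm
  have hm0 : 0 < m := Real.sin_pos_of_pos_of_lt_pi hε (by linarith)
  set K := 2 * Real.exp (a ^ 2 + 2) * (a ^ 2 * (1 + a)) + a + a ^ 2 with hK
  have hK0 : 0 < K := by positivity
  obtain ⟨τ, hτ0, hτ1, hτa, hτm, hτη⟩ : ∃ τ : ℝ, 0 < τ ∧ τ ≤ 1 ∧ a * τ ≤ 1 ∧
      K * (2 * τ) ≤ m / 2 ∧ K * (2 * τ) * (1 + a) * 2 < η * m ^ 2 := by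
    refine ⟨min (min 1 (1 / a)) (min (m / 2 / (2 * K)) (η * m ^ 2 / (8 * K * (1 + a)))), ?_, ?_, ?_, ?_, ?_⟩
    · positivity
    · exact (min_le_left _ _).trans (min_le_left _ _)
    · have := (min_le_left (min 1 (1 / a)) (min (m / 2 / (2 * K)) (η * m ^ 2 / (8 * K * (1 + a))))).trans (min_le_right _ _)
      rw [le_div_iff₀ ha] at this
      linarith
    · have := (min_le_right (min 1 (1 / a)) (min (m / 2 / (2 * K)) (η * m ^ 2 / (8 * K * (1 + a))))).trans (min_le_left _ _)
      rw [le_div_iff₀ (by positivity)] at this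
      linarith
    · have := (min_le_right (min 1 (1 / a)) (min (m / 2 / (2 * K)) (η * m ^ 2 / (8 * K * (1 + a))))).trans (min_le_right _ _)
      rw [le_div_iff₀ (by positivity)] at this
      have : 0 < η * m ^ 2 := by positivity
      linarith
  obtain ⟨N₁, hN₁⟩ := hLLN τ hτ0
  obtain ⟨N₂, hN₂⟩ := exists_nat_gt (1 / τ)
  refine ⟨max N₁ (max N₂ 2), fun N hN u hu => ?_⟩
  have hNN₁ : N₁ ≤ N := le_trans (le_max_left _ _) hN
  have hNN₂ : N₂ ≤ N := le_trans (le_trans (le_max_left _ _) (le_max_right _ _)) hN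
  have hN2 : 2 ≤ N := le_trans (le_trans (le_max_right _ _) (le_max_right _ _)) hN
  have hNpos : (0 : ℝ) < N := by exact_mod_cast (by omega : 0 < N)
  have hL := hN₁ N hNN₁
  set h : ℝ := (N : ℝ)⁻¹ with hh
  have hh0 : 0 < h := by positivity
  have hhN : h * N = 1 := inv_mul_cancel₀ hNpos.ne'
  have hhτ : h ≤ τ := by
    rw [hh]
    apply inv_le_of_inv_le₀ hτ0
    rw [← one_div]
    have : (N₂ : ℝ) ≤ N := by exact_mod_cast hNN₂
    linarith
  obtain ⟨hu0, hu1⟩ := hu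
  have hu2 : u ≤ 1 := hu1.trans (min_le_left _ _)
  have hu3 : a * u ≤ Real.pi / 2 - ε := by
    have := hu1.trans (min_le_right _ _)
    rw [le_div_iff₀ ha] at this
    linarith
  -- the index
  obtain ⟨k, hk, hkN, hku, hku'⟩ : ∃ k : ℕ, max ⌈u * N⌉₊ 1 = k + 1 ∧ k + 1 ≤ N ∧
      (k : ℝ) ≤ u * N ∧ u * N ≤ k + 1 := by
    have hc : ⌈u * N⌉₊ ≤ N := by
      apply Nat.ceil_le.2; nlinarith
    have hle : u * N ≤ ⌈u * N⌉₊ := Nat.le_ceil _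
    rcases Nat.eq_zero_or_pos ⌈u * N⌉₊ with h0 | h0
    · refine ⟨0, by rw [h0]; rfl, by omega, by simp; positivity, ?_⟩
      rw [h0] at hle; push_cast at *; linarith
    · have hlt : (⌈u * N⌉₊ : ℝ) < u * N + 1 := Nat.ceil_lt_add_one (by positivity)
      refine ⟨⌈u * N⌉₊ - 1, by omega, by omega, ?_, ?_⟩
      · rw [Nat.cast_sub h0]; push_cast; linarith
      · rw [Nat.cast_sub h0]; push_cast; linarith
  rw [hk]
  set q : ℕ → ℝ := fun j => if j = 0 then 1 else r N j with hqd
  set e : ℕ → ℝ := fun j => ∑ i ∈ Finset.range j, h * (q i - 1) with hed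
  have he0 : e 0 = 0 := by simp [hed]
  have he : ∀ j, e (j + 1) = e j + h * (q j - 1) := fun j => by
    simp only [hed, Finset.sum_range_succ]
  have hee : ∀ j, e (j + 1) = h * (rsum (r N) 1 (j + 1) - (((j + 1 : ℕ) : ℝ) - ((1 : ℕ) : ℝ))) := by
    intro j
    induction j with
    | zero => rw [he, he0]; simp [hqd, rsum]
    | succ j ih =>
      rw [he, ih]
      simp only [rsum]
      rw [Finset.sum_Ico_succ_top (by omega : 1 ≤ j + 1)]
      simp only [hqd]
      rw [if_neg (by omega)]
      push_cast; ring
  have heb : ∀ j ≤ N, |e j| ≤ τ := by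
    intro j hj
    rcases j with _ | j
    · rw [he0, abs_zero]; exact hτ0.le
    · rcases j with _ | j
      · rw [he, he0]; simp [hqd]; exact hτ0.le
      · rw [hee, abs_mul, abs_of_pos hh0]
        have := hL 1 (j + 2) le_rfl (by omega) hj
        calc _ ≤ h * (τ * N) := by gcongr
          _ = τ * (h * N) := by ring
          _ = τ := by rw [hhN, mul_one]
  have hq0 : ∀ j < N, 0 ≤ q j := by
    intro j hj
    simp only [hqd]
    split_ifs with h0
    · norm_num
    · exact (hr N hN2 j (by omega) (by omega)).le
  have G := gron h a τ hh0 ha hτ0.le (by nlinarith) q N hq0 e he0 he heb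
  have G' : ∀ j ≤ N, |(CS h (a ^ 2) q j).1 - Real.cos (a * h * j)| ≤
        2 * Real.exp (a ^ 2 + 2) * (a ^ 2 * (1 + a)) * (2 * τ) + τ * a ∧
      |(CS h (a ^ 2) q j).2 - a * Real.sin (a * h * j)| ≤
        2 * Real.exp (a ^ 2 + 2) * (a ^ 2 * (1 + a)) * (2 * τ) := by
    intro j hj
    have g := G j hj
    have hej := heb j hj
    have hjN : h * j ≤ 1 := by
      rw [← hhN]; have : (j : ℝ) ≤ N := by exact_mod_cast hj
      gcongr
    have hb : Real.exp (a ^ 2 * h * j + (h * j + e j)) *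
        (2 * (a ^ 2 * (h + τ) * (1 + a)) * h * j) ≤
        2 * Real.exp (a ^ 2 + 2) * (a ^ 2 * (1 + a)) * (2 * τ) := by
      have x1 : a ^ 2 * h * j + (h * j + e j) ≤ a ^ 2 + 2 := by
        have := (abs_le.1 hej).2
        have : a ^ 2 * (h * j) ≤ a ^ 2 * 1 := by gcongr
        linarith
      calc _ = Real.exp (a ^ 2 * h * j + (h * j + e j)) *
            (2 * (a ^ 2 * (h + τ) * (1 + a)) * (h * j)) := by ring
        _ ≤ Real.exp (a ^ 2 + 2) * (2 * (a ^ 2 * (τ + τ) * (1 + a)) * 1) := by gcongr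
        _ = _ := by ring
    have hes : |e j * (a * Real.sin (a * h * j))| ≤ τ * a := by
      rw [abs_mul, abs_mul, abs_of_pos ha]
      calc _ ≤ τ * (a * 1) := by gcongr; exact Real.abs_sin_le_one _
        _ = _ := by ring
    constructor
    · have v := abs_sub ((CS h (a ^ 2) q j).1 - Real.cos (a * h * j) + e j * (a * Real.sin (a * h * j)))
        (e j * (a * Real.sin (a * h * j)))
      rw [add_sub_cancel_right] at v
      have := abs_nonneg ((CS h (a ^ 2) q j).2 - a * Real.sin (a * h * j))
      linarith
    · have := abs_nonneg ((CS h (a ^ 2) q j).1 - Real.cos (a * h * j) + e j * (a * Real.sin (a * h * j)))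
      linarith
  have hcos : ∀ t, 0 ≤ t → t ≤ Real.pi / 2 - ε → m ≤ Real.cos t := by
    intro t h0 h1
    rw [hm, ← Real.cos_pi_div_two_sub]
    exact Real.cos_le_cos_of_nonneg_of_le_pi h0 (by linarith [Real.pi_pos]) h1
  have hhu : h * k ≤ u := by
    calc h * k ≤ h * (u * N) := by gcongr
      _ = u * (h * N) := by ring
      _ = u := by rw [hhN, mul_one]
  have hhu' : u ≤ h * k + h := by
    calc u = u * (h * N) := by rw [hhN, mul_one]
      _ = h * (u * N) := by ring
      _ ≤ h * (k + 1) := by gcongr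
      _ = _ := by ring
  set W := 2 * Real.exp (a ^ 2 + 2) * (a ^ 2 * (1 + a)) * (2 * τ) with hW
  have hKW : W + a * (2 * τ) + a ^ 2 * (2 * τ) = K * (2 * τ) := by rw [hW, hK]; ring
  have hW0 : 0 ≤ W := by positivity
  have ha2 : 0 < a ^ 2 * τ := by positivity
  have ha1 : 0 < a * τ := by positivity
  have hCpos : ∀ j ≤ k, (CS h (a ^ 2) q j).1 ≠ 0 := by
    intro j hj
    have g := (G' j (by omega)).1
    have hjk : h * j ≤ h * k := by
      have : (j : ℝ) ≤ k := by exact_mod_cast hj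
      gcongr
    have := hcos (a * h * j) (by positivity) (by
      calc a * h * j = a * (h * j) := by ring
        _ ≤ a * u := by gcongr; linarith
        _ ≤ _ := hu3)
    have := (abs_le.1 g).1
    intro h0
    linarith
  rw [Bseq_eq N (r N) q (a ^ 2) (fun j hj => by simp only [hqd]; rw [if_neg (by omega)]) k hCpos]
  obtain ⟨g1, g2⟩ := G' k (by omega)
  have hdist : |a * h * k - a * u| ≤ a * τ := by
    rw [abs_le]; constructor <;> nlinarith
  have d1 := (Real.abs_cos_sub_cos_le (a * h * k) (a * u)).trans hdist
  have d2 := (Real.abs_sin_sub_sin_le (a * h * k) (a * u)).trans hdist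
  set C := (CS h (a ^ 2) q k).1
  set S := (CS h (a ^ 2) q k).2
  have f1 : |C - Real.cos (a * u)| ≤ K * (2 * τ) := by
    have := abs_sub_le C (Real.cos (a * h * k)) (Real.cos (a * u))
    linarith
  have f2 : |S - a * Real.sin (a * u)| ≤ K * (2 * τ) := by
    have := abs_sub_le S (a * Real.sin (a * h * k)) (a * Real.sin (a * u))
    have h5 : |a * Real.sin (a * h * k) - a * Real.sin (a * u)| ≤ a * (a * τ) := by
      rw [← mul_sub, abs_mul, abs_of_pos ha]; gcongr
    nlinarith
  have hcu : m ≤ Real.cos (a * u) := hcos _ (by positivity) hu3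
  have hC : m / 2 ≤ C := by
    have := (abs_le.1 f1).1
    linarith
  have hs1 := Real.abs_sin_le_one (a * u)
  have hc1 := Real.abs_cos_le_one (a * u)
  rw [Real.tan_eq_sin_div_cos]
  set c := Real.cos (a * u)
  set s := Real.sin (a * u)
  have hc0 : 0 < c := by linarith
  have hC0 : 0 < C := by linarith
  have key : S / C - a * (s / c) = ((S - a * s) * c - a * s * (C - c)) / (C * c) := by
    field_simp; ring
  rw [key, abs_div, abs_of_pos (mul_pos hC0 hc0), div_lt_iff₀ (mul_pos hC0 hc0)]
  have n1 : |(S - a * s) * c - a * s * (C - c)| ≤ K * (2 * τ) * (1 + a) := by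
    calc _ ≤ |(S - a * s) * c| + |a * s * (C - c)| := abs_sub _ _
      _ = |S - a * s| * |c| + a * |s| * |C - c| := by
        rw [abs_mul, abs_mul, abs_mul, abs_of_pos ha]
      _ ≤ K * (2 * τ) * 1 + a * 1 * (K * (2 * τ)) := by gcongr
      _ = _ := by ring
  have n2 : m / 2 * m ≤ C * c := by gcongr
  nlinarith
end

section
/- Let (r^(N))_{N≥2} be a family of resistances satisfying condition (LLN), let α > 0, and define B̂^(N) : {1,…,N+1} → ℝ by B̂^(N)(1) = 0, B̂^(N)(2) = α/N, and B̂^(N)(x+1) = B̂^(N)(x) + N^{−1}·r^(N)(x−1)·B̂^(N)(x)² + α/N for 2 ≤ x ≤ N. Then for every ε > 0, lim_{N→∞} max { |B̂^(N)(x) − √α·tan(√α·r^(N)(1,x−1)/N)| : x ∈ {2,…,N+1} with √α·r^(N)(1,x−1)/N ≤ π/2 − ε } = 0. -/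
/-- The sequence `B̂^{(N)}`: `B̂(1) = 0` and
`B̂(x+1) = B̂(x) + N⁻¹·r(x−1)·B̂(x)² + α/N` (so `B̂(2) = α/N`). -/
noncomputable def Bhat (N : ℕ) (r : ℕ → ℝ) (α : ℝ) : ℕ → ℝ
  | 0 => 0
  | 1 => 0
  | x + 2 => Bhat N r α (x + 1) + (N : ℝ)⁻¹ * r x * (Bhat N r α (x + 1)) ^ 2 + α / N

lemma tan_step (α : ℝ) (hα : 0 < α) (S M : ℝ) (hS : Real.sqrt α * S < Real.pi / 2)
    (hM : M = Real.sqrt α * Real.tan (Real.sqrt α * S)) (s s' : ℝ) (h0 : 0 ≤ s) (h1 : s ≤ s')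
    (h2 : s' ≤ S) :
    0 ≤ Real.sqrt α * Real.tan (Real.sqrt α * s) ∧
    Real.sqrt α * Real.tan (Real.sqrt α * s) ≤ M ∧
    |Real.sqrt α * Real.tan (Real.sqrt α * s') - Real.sqrt α * Real.tan (Real.sqrt α * s)
      - (s' - s) * ((Real.sqrt α * Real.tan (Real.sqrt α * s)) ^ 2 + α)|
      ≤ 2 * M * (M ^ 2 + α) * (s' - s) ^ 2 := by
  have hq : 0 < Real.sqrt α := Real.sqrt_pos.2 hα
  have hqq : Real.sqrt α ^ 2 = α := Real.sq_sqrt hα.le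
  set q := Real.sqrt α with hqdef
  set T : ℝ → ℝ := fun s => q * Real.tan (q * s) with hT
  have hrange : ∀ u, 0 ≤ u → u ≤ S → 0 ≤ q * u ∧ q * u < Real.pi / 2 := fun u hu hu' =>
    ⟨by positivity, lt_of_le_of_lt (mul_le_mul_of_nonneg_left hu' hq.le) hS⟩
  have hpi := Real.pi_pos
  have hnn : ∀ u, 0 ≤ u → u ≤ S → 0 ≤ T u := fun u hu hu' => by
    obtain ⟨a, b⟩ := hrange u hu hu'
    exact mul_nonneg hq.le (Real.tan_nonneg_of_nonneg_of_le_pi_div_two a b.le)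
  have hmono : ∀ u v, 0 ≤ u → u ≤ v → v ≤ S → T u ≤ T v := fun u v hu huv hv => by
    obtain ⟨a, b⟩ := hrange u hu (huv.trans hv)
    obtain ⟨c, d⟩ := hrange v (hu.trans huv) hv
    refine mul_le_mul_of_nonneg_left ?_ hq.le
    exact Real.strictMonoOn_tan.monotoneOn ⟨by linarith, b⟩ ⟨by linarith, d⟩
      (mul_le_mul_of_nonneg_left huv hq.le)
  have hder : ∀ u, 0 ≤ u → u ≤ S → HasDerivAt T (T u ^ 2 + α) u := fun u hu hu' => by
    obtain ⟨a, b⟩ := hrange u hu hu'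
    have hc : Real.cos (q * u) ≠ 0 := (Real.cos_pos_of_mem_Ioo ⟨by linarith, b⟩).ne'
    have h := (((Real.hasDerivAt_tan hc).comp u ((hasDerivAt_id u).const_mul q)).const_mul q)
    refine h.congr_deriv ?_
    simp only [hT]
    rw [← hqq, Real.tan_eq_sin_div_cos]
    field_simp
    nlinarith [Real.sin_sq_add_cos_sq (q * u)]
  have hmvt : ∀ u v, 0 ≤ u → u ≤ v → v ≤ S →
      ∃ ξ, u ≤ ξ ∧ ξ ≤ v ∧ T v - T u = (v - u) * (T ξ ^ 2 + α) := fun u v hu huv hv => by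
    rcases huv.eq_or_lt with rfl | hlt
    · exact ⟨u, le_rfl, le_rfl, by simp⟩
    · obtain ⟨ξ, hξ, h⟩ := exists_hasDerivAt_eq_slope T (fun u => T u ^ 2 + α) hlt
        (fun w hw => (hder w (hu.trans hw.1) (hw.2.trans hv)).continuousAt.continuousWithinAt)
        (fun w hw => hder w (hu.trans hw.1.le) (hw.2.le.trans hv))
      refine ⟨ξ, hξ.1.le, hξ.2.le, ?_⟩
      have : v - u ≠ 0 := (sub_pos.2 hlt).ne'
      rw [h]; field_simp
  have hMT : M = T S := hM
  have hle : ∀ u, 0 ≤ u → u ≤ S → T u ≤ M := fun u hu hu' => hMT ▸ hmono u S hu hu' le_rfl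
  have hMn : 0 ≤ M := (hnn s h0 (h1.trans h2)).trans (hle s h0 (h1.trans h2))
  refine ⟨hnn s h0 (h1.trans h2), hle s h0 (h1.trans h2), ?_⟩
  obtain ⟨ξ, a, b, h⟩ := hmvt s s' h0 h1 h2
  obtain ⟨ζ, a', b', h'⟩ := hmvt s ξ h0 a (b.trans h2)
  change |T s' - T s - (s' - s) * (T s ^ 2 + α)| ≤ _
  have e1 : T s' - T s - (s' - s) * (T s ^ 2 + α) = (s' - s) * ((T ξ + T s) * (T ξ - T s)) := by
    rw [h]; ring
  have k0 := hmono s ξ h0 a (b.trans h2)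
  have k1 := hle ξ (h0.trans a) (b.trans h2)
  have k2 := hle ζ (h0.trans a') (b'.trans (b.trans h2))
  have k3 := hnn ζ (h0.trans a') (b'.trans (b.trans h2))
  have k4 := hnn s h0 (h1.trans h2)
  have k5 : T ξ - T s ≤ (s' - s) * (M ^ 2 + α) := by
    rw [h']
    have : T ζ ^ 2 ≤ M ^ 2 := pow_le_pow_left₀ k3 k2 2
    exact mul_le_mul (by linarith) (by linarith) (by positivity) (by linarith)
  rw [e1, abs_of_nonneg (mul_nonneg (by linarith) (mul_nonneg (by linarith) (by linarith)))]
  have k6 : (T ξ + T s) * (T ξ - T s) ≤ (2 * M) * ((s' - s) * (M ^ 2 + α)) :=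
    mul_le_mul (by linarith) k5 (by linarith) (by linarith)
  calc _ ≤ (s' - s) * ((2 * M) * ((s' - s) * (M ^ 2 + α))) :=
        mul_le_mul_of_nonneg_left k6 (by linarith)
    _ = _ := by ring

lemma gron_s15 (b s : ℕ → ℝ) (T : ℝ → ℝ) (α S M K e δ L A h : ℝ) (n : ℕ)
    (hL : L = 2 * M + 2) (hA : A = e + K * δ / L) (he : 0 ≤ e) (he1 : e ≤ 1) (hK : 0 ≤ K)
    (hM : 0 ≤ M) (hδ : 0 ≤ δ) (hs1 : s 1 = 0) (hT0 : T 0 = 0) (hb1 : b 1 = α * h)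
    (hrec : ∀ k, 1 ≤ k → k < n → b (k+1) = b k + (s (k+1) - s k) * b k ^ 2 + α * h)
    (hst : ∀ k, 1 ≤ k → k < n → s k ≤ s (k+1) ∧ s (k+1) - s k ≤ δ)
    (hd : ∀ k, 1 ≤ k → k ≤ n → |α * (k * h - s k)| ≤ e)
    (hS : ∀ k, 1 ≤ k → k ≤ n → s k ≤ S)
    (hT : ∀ k, 1 ≤ k → k < n → 0 ≤ T (s k) ∧ T (s k) ≤ M ∧
      |T (s (k+1)) - T (s k) - (s (k+1) - s k) * (T (s k) ^ 2 + α)| ≤ K * (s (k+1) - s k) ^ 2)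
    (hsm : Real.exp (L * S) * A ≤ 1) (k : ℕ) (hk : 1 ≤ k) (hkn : k ≤ n) :
    |b k - α * (k * h - s k) - T (s k)| + A ≤ Real.exp (L * s k) * A := by
  have hLp : 0 < L := by linarith
  have hA0 : 0 ≤ A := by rw [hA]; positivity
  induction k, hk using Nat.le_induction with
  | base => simp [hs1, hT0, hb1]
  | succ k hk ih =>
    have ih := ih (by omega)
    have hkn' : k < n := by omega
    obtain ⟨t0, t1, t2⟩ := hT k hk hkn'
    obtain ⟨d0, d1⟩ := hst k hk hkn'
    have hdk := hd k hk hkn'.le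
    have hE1 : |b k - α * (k * h - s k) - T (s k)| ≤ 1 := by
      have : Real.exp (L * s k) * A ≤ Real.exp (L * S) * A := by
        have := hS k hk hkn'.le
        gcongr
      linarith
    have hr := hrec k hk hkn'
    set D := s (k+1) - s k with hD
    set E := b k - α * (k * h - s k) - T (s k) with hE
    set w := α * (k * h - s k) with hw
    have hD0 : 0 ≤ D := by linarith
    have hbk : b k = E + w + T (s k) := by rw [hE]; ring
    have key : b (k+1) - α * ((k+1 : ℕ) * h - s (k+1)) - T (s (k+1)) =
        E + D * ((E + w) * (E + w + 2 * T (s k)))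
          - (T (s (k+1)) - T (s k) - D * (T (s k) ^ 2 + α)) := by
      have h3 : α * ((k+1 : ℕ) * h - s (k+1)) = w + α * h - α * D := by
        rw [hw, hD]; push_cast; ring
      rw [h3, hr, hbk]; ring
    have hEw : |E + w| ≤ |E| + e := (abs_add_le _ _).trans (by linarith)
    have h4 : |E + w + 2 * T (s k)| ≤ L := by
      refine (abs_add_le _ _).trans ?_
      rw [abs_of_nonneg (by linarith : 0 ≤ 2 * T (s k))]
      linarith
    have h5 : |D * ((E + w) * (E + w + 2 * T (s k)))| ≤ D * ((|E| + e) * L) := by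
      rw [abs_mul, abs_mul, abs_of_nonneg hD0]
      gcongr
    have h6 : K * D ^ 2 ≤ D * (K * δ) := by
      have := mul_le_mul_of_nonneg_left d1 (mul_nonneg hK hD0)
      nlinarith
    have h7 : |b (k+1) - α * ((k+1 : ℕ) * h - s (k+1)) - T (s (k+1))|
        ≤ |E| + D * ((|E| + e) * L) + D * (K * δ) := by
      rw [key]
      refine (abs_sub _ _).trans ?_
      have := abs_add_le E (D * ((E + w) * (E + w + 2 * T (s k))))
      linarith
    have h8 : L * A = e * L + K * δ := by rw [hA]; field_simp
    have h9 : 1 + L * D ≤ Real.exp (L * D) := by linarith [Real.add_one_le_exp (L * D)]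
    have hLs : L * s (k+1) = L * D + L * s k := by rw [hD]; ring
    rw [hLs, Real.exp_add]
    calc _ ≤ |E| + D * ((|E| + e) * L) + D * (K * δ) + A := by linarith
      _ = (1 + L * D) * (|E| + A) := by linear_combination (-D) * h8
      _ ≤ Real.exp (L * D) * (Real.exp (L * s k) * A) := by gcongr
      _ = _ := by ring

/-- Under (LLN), `B̂^{(N)}(x)` is uniformly approximated by
`√α·tan(√α·r^{(N)}(1,x−1)/N)` on `{x : √α·r^{(N)}(1,x−1)/N ≤ π/2 − ε}`. -/
theorem Bhat_homogenization (r : ℕ → ℕ → ℝ)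
    (hr : ∀ N, 2 ≤ N → ∀ x, 1 ≤ x → x ≤ N - 1 → 0 < r N x)
    (hLLN : LLN r) (α : ℝ) (hα : 0 < α) (ε : ℝ) (hε : 0 < ε) :
    ∀ η > (0 : ℝ), ∃ N₀ : ℕ, ∀ N ≥ N₀, ∀ x ∈ Finset.Icc 2 (N + 1),
      Real.sqrt α * rsum (r N) 1 (x - 1) / N ≤ Real.pi / 2 - ε →
        |Bhat N (r N) α x -
          Real.sqrt α * Real.tan (Real.sqrt α * rsum (r N) 1 (x - 1) / N)| < η := by
  intro η hη
  have hpi := Real.pi_pos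
  have hq : 0 < Real.sqrt α := Real.sqrt_pos.2 hα
  by_cases hε2 : Real.pi / 2 < ε
  · refine ⟨2, fun N hN x hx hle => ?_⟩
    exfalso
    rw [Finset.mem_Icc] at hx
    have : 0 ≤ rsum (r N) 1 (x - 1) := Finset.sum_nonneg fun i hi => by
      rw [Finset.mem_Ico] at hi
      exact (hr N hN i hi.1 (by omega)).le
    have : 0 ≤ Real.sqrt α * rsum (r N) 1 (x - 1) / N := by positivity
    linarith
  push Not at hε2
  obtain ⟨S, hSdef⟩ : ∃ S, S = (Real.pi / 2 - ε) / Real.sqrt α := ⟨_, rfl⟩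
  have hqS : Real.sqrt α * S = Real.pi / 2 - ε := by rw [hSdef]; field_simp
  have hS0 : 0 ≤ S := by rw [hSdef]; exact div_nonneg (by linarith) hq.le
  obtain ⟨M, hM⟩ : ∃ M, M = Real.sqrt α * Real.tan (Real.sqrt α * S) := ⟨_, rfl⟩
  have hstep := tan_step α hα S M (by linarith) hM
  have hM0 : 0 ≤ M := by
    have := hstep 0 0 le_rfl le_rfl hS0
    linarith [this.1, this.2.1]
  obtain ⟨L, hL⟩ : ∃ L, L = 2 * M + 2 := ⟨_, rfl⟩
  obtain ⟨K, hK⟩ : ∃ K, K = 2 * M * (M ^ 2 + α) := ⟨_, rfl⟩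
  have hL0 : 0 < L := by linarith
  have hK0 : 0 ≤ K := by rw [hK]; positivity
  obtain ⟨C, hC⟩ : ∃ C, C = Real.exp (L * S) * (1 + K / L) := ⟨_, rfl⟩
  have hC0 : 0 ≤ C := by rw [hC]; positivity
  obtain ⟨e, he⟩ : ∃ e, e = min 1 (η / 2) / (C + 1) := ⟨_, rfl⟩
  have hm0 : 0 < min 1 (η / 2) := lt_min one_pos (by linarith)
  have he0 : 0 < e := by rw [he]; positivity
  have heC : C * e + e = min 1 (η / 2) := by rw [he]; field_simp
  have hCe : 0 ≤ C * e := by positivity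
  have hm1 := min_le_left 1 (η / 2)
  have hm2 := min_le_right 1 (η / 2)
  obtain ⟨g, hg⟩ : ∃ g, g = e / (2 * (α + 1)) := ⟨_, rfl⟩
  have hg0 : 0 < g := by rw [hg]; positivity
  have hge : 2 * g * (α + 1) = e := by rw [hg]; field_simp
  obtain ⟨N₁, hN₁⟩ := hLLN g hg0
  obtain ⟨N₂, hN₂⟩ := exists_nat_gt (1 / g)
  refine ⟨max 2 (max N₁ N₂), fun N hN x hx hle => ?_⟩
  rw [Finset.mem_Icc] at hx
  have hN2 : 2 ≤ N := le_trans (le_max_left _ _) hN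
  have hNN1 : N₁ ≤ N := le_trans (le_trans (le_max_left _ _) (le_max_right _ _)) hN
  have hNN2 : N₂ ≤ N := le_trans (le_trans (le_max_right _ _) (le_max_right _ _)) hN
  have hNp : (0 : ℝ) < N := by positivity
  have hNg : 1 ≤ g * N := by
    have : 1 / g ≤ N := hN₂.le.trans (by exact_mod_cast hNN2)
    rw [div_le_iff₀ hg0] at this; linarith
  have hLN := hN₁ N hNN1
  obtain ⟨n, rfl⟩ : ∃ n, x = n + 1 := ⟨x - 1, by omega⟩
  simp only [Nat.add_sub_cancel] at hle ⊢
  have hn1 : 1 ≤ n := by omega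
  have hnN : n ≤ N := by omega
  obtain ⟨s, hs⟩ : ∃ s : ℕ → ℝ, s = fun k => rsum (r N) 1 k / N := ⟨_, rfl⟩
  have hsS : ∀ k, 1 ≤ k → s (k+1) - s k = r N k / N := fun k hk => by
    simp only [hs, rsum]
    rw [Finset.sum_Ico_succ_top hk]; ring
  have hs1 : s 1 = 0 := by simp [hs, rsum]
  have hrn : ∀ k, 1 ≤ k → k < n → 0 < r N k := fun k h1 h2 => hr N hN2 k h1 (by omega)
  have hmono : ∀ i j, 1 ≤ i → i ≤ j → j ≤ n → s i ≤ s j := fun i j hi hij hj => by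
    simp only [hs, rsum]
    refine div_le_div_of_nonneg_right ?_ hNp.le
    refine Finset.sum_le_sum_of_subset_of_nonneg (Finset.Ico_subset_Ico le_rfl hij) ?_
    intro k hk _
    rw [Finset.mem_Ico] at hk
    exact (hrn k hk.1 (by omega)).le
  have hsn : s n ≤ S := by
    rw [hSdef, le_div_iff₀ hq]
    simp only [hs]
    calc _ = Real.sqrt α * rsum (r N) 1 n / N := by ring
      _ ≤ _ := hle
  have hs0 : ∀ k, 1 ≤ k → k ≤ n → 0 ≤ s k := fun k h1 h2 => hs1 ▸ hmono 1 k le_rfl h1 h2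
  have hd : ∀ k : ℕ, 1 ≤ k → k ≤ n → |α * (k * (1 / (N : ℝ)) - s k)| ≤ e := fun k h1 h2 => by
    have h3 : |rsum (r N) 1 k - (k - 1)| ≤ g * N := by
      rcases h1.eq_or_lt with rfl | h
      · simp [rsum]; positivity
      · simpa using hLN 1 k le_rfl h (by omega)
    have h4 : |(k : ℝ) - rsum (r N) 1 k| ≤ 2 * g * N := by
      rw [abs_le] at h3 ⊢
      constructor <;> linarith
    have h5 : (k : ℝ) * (1 / (N : ℝ)) - s k = (k - rsum (r N) 1 k) / N := by
      simp only [hs]; ring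
    have h6 : |(k : ℝ) * (1 / (N : ℝ)) - s k| ≤ 2 * g := by
      rw [h5, abs_div, abs_of_pos hNp, div_le_iff₀ hNp]; exact h4
    rw [abs_mul, abs_of_pos hα]
    calc _ ≤ α * (2 * g) := by gcongr
      _ ≤ e := by linarith
  have hst : ∀ k, 1 ≤ k → k < n → s k ≤ s (k+1) ∧ s (k+1) - s k ≤ e := fun k h1 h2 => by
    refine ⟨hmono k (k+1) h1 (by omega) (by omega), ?_⟩
    have := hLN k (k+1) h1 (by omega) (by omega)
    rw [rsum, Finset.sum_Ico_succ_top le_rfl] at this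
    simp at this
    rw [hsS k h1, div_le_iff₀ hNp]
    have h3 := (abs_le.1 this).2
    have h4 : 0 ≤ g * α * N := by positivity
    rw [← hge]
    nlinarith
  have hT : ∀ k, 1 ≤ k → k < n → _ := fun k h1 h2 =>
    hstep (s k) (s (k+1)) (hs0 k h1 h2.le) (hst k h1 h2).1
      ((hmono (k+1) n (by omega) (by omega) le_rfl).trans hsn)
  rw [← hK] at hT
  have hCA : Real.exp (L * S) * (e + K * e / L) = C * e := by rw [hC]; ring
  have main := gron_s15 (fun k => Bhat N (r N) α (k+1)) s
    (fun s => Real.sqrt α * Real.tan (Real.sqrt α * s)) α S M K e e L _ (1 / N) n hL rfl he0.le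
    (by linarith) hK0 hM0 he0.le hs1 (by simp) (by simp [Bhat, div_eq_mul_inv])
    (fun k h1 h2 => by
      rw [hsS k h1]
      simp only [Bhat]
      ring) hst hd (fun k h1 h2 => (hmono k n h1 h2 le_rfl).trans hsn) hT
    (by rw [hCA]; linarith) n hn1 le_rfl
  have hsx : Real.sqrt α * rsum (r N) 1 n / N = Real.sqrt α * s n := by simp only [hs]; ring
  rw [hsx]
  have hAp : 0 < e + K * e / L := by positivity
  have hex : Real.exp (L * s n) * (e + K * e / L) ≤ C * e := by
    rw [← hCA]; gcongr
  have hdn := abs_le.1 (hd n hn1 le_rfl)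
  have h1 := abs_le.1 (by linarith :
    |Bhat N (r N) α (n + 1) - α * (n * (1 / (N : ℝ)) - s n) -
      Real.sqrt α * Real.tan (Real.sqrt α * s n)| ≤ C * e)
  rw [abs_lt]
  constructor <;> linarith [h1.1, h1.2, hdn.1, hdn.2]
end
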